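/- There exists an absolute constant C > 0 such that: if f : ℂ → ℂ admits a Littlewood–Paley decomposition with homogeneous Besov B¹_{∞1}(ℝ²)-norm at most M, then for all bounded normal operators N₁, N₂ on a complex Hilbert space H and every bounded operator Q on H, one has ‖f(N₁)Q − Q f(N₂)‖ ≤ C · M · max{ ‖N₁Q − QN₂‖, ‖N₁*Q − QN₂*‖ }. -/

import Mathlib

open MeasureTheory Filter
open scoped FourierTransform

/-- Fourier transform of `f` (as a tempered distribution, identifying `ℝ²` with `ℂ`)
is supported in the closed disc of radius `σ` centered at the origin. -/
def FourierSupportedIn (f : ℂ → ℂ) (σ : ℝ) : Prop :=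
  ∀ φ : SchwartzMap ℂ ℂ, Disjoint (tsupport ⇑φ) (Metric.closedBall (0 : ℂ) σ) →
    ∫ x : ℂ, f x * 𝓕 (⇑φ) x = 0

/-- `f : ℂ → ℂ` admits a Littlewood–Paley decomposition with homogeneous Besov
`B¹_{∞1}(ℝ²)`-norm at most `M`. -/
def HasLPDecompBesov1 (f : ℂ → ℂ) (M : ℝ) : Prop :=
  ∃ F : ℤ → BoundedContinuousFunction ℂ ℂ,
    (∀ n : ℤ, FourierSupportedIn (⇑(F n)) ((2 : ℝ) ^ (n + 1))) ∧
    (∀ K : Set ℂ, IsCompact K →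
      TendstoUniformlyOn (fun (N : ℕ) z => ∑ n ∈ Finset.Icc (-(N : ℤ)) (N : ℤ), F n z)
        f atTop K) ∧
    (Summable fun n : ℤ => (2 : ℝ) ^ n * ‖F n‖) ∧
    ∑' n : ℤ, (2 : ℝ) ^ n * ‖F n‖ ≤ M

open scoped SchwartzMap in
lemma fourier_postcompCLM_apply {V W : Type*} [NormedAddCommGroup V] [NormedSpace ℂ V]
    [CompleteSpace V] [NormedAddCommGroup W] [NormedSpace ℂ W] [CompleteSpace W] (L : V →L[ℂ] W)
    (G : 𝓢(ℂ, V)) (w : ℂ) :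
    𝓕 (SchwartzMap.postcompCLM L G) w = L (𝓕 G w) := by
  rw [SchwartzMap.fourier_coe, SchwartzMap.fourier_coe, Real.fourier_eq, Real.fourier_eq,
    ← ContinuousLinearMap.integral_comp_comm]
  · simp [Circle.smul_def]
  · exact (Real.fourierIntegral_convergent_iff w).2 G.integrable

section Plancherel

variable {H : Type*} [NormedAddCommGroup H] [InnerProductSpace ℂ H] [CompleteSpace H]

open scoped SchwartzMap InnerProductSpace

/-- A Plancherel bound for operator-valued Schwartz functions supported in a disc. -/
lemma integral_norm_sq_fourier_apply_le (G : 𝓢(ℂ, H →L[ℂ] H)) {r c : ℝ} (hr : 0 ≤ r)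
    (hs : ∀ ξ, r < ‖ξ‖ → G ξ = 0) (hb : ∀ ξ, ‖G ξ‖ ≤ c) (u : H) :
    MemLp (fun w => ‖𝓕 G w u‖) 2 volume ∧
      ∫ w, ‖𝓕 G w u‖ ^ 2 ≤ (c * ‖u‖) ^ 2 * (Real.pi * r ^ 2) := by
  let g : 𝓢(ℂ, H) := SchwartzMap.postcompCLM (𝕜 := ℂ) (ContinuousLinearMap.apply ℂ H u) G
  have hg : ∀ ξ, g ξ = G ξ u := fun ξ => rfl
  have hFg : ∀ w, 𝓕 g w = 𝓕 G w u := fourier_postcompCLM_apply _ G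
  simp_rw [← hFg]
  refine ⟨((𝓕 g).memLp 2 volume).norm, ?_⟩
  rw [SchwartzMap.integral_norm_sq_fourier]
  have hsupp : ∀ ξ, ξ ∉ Metric.closedBall (0 : ℂ) r → ‖g ξ‖ ^ 2 = 0 := by
    intro ξ hξ
    rw [hg, hs ξ (by simpa using hξ)]
    simp
  rw [← setIntegral_eq_integral_of_forall_compl_eq_zero hsupp]
  have hle : ∀ ξ ∈ Metric.closedBall (0 : ℂ) r, ‖‖g ξ‖ ^ 2‖ ≤ (c * ‖u‖) ^ 2 := by
    intro ξ _
    rw [Real.norm_of_nonneg (by positivity), hg]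
    gcongr
    exact (G ξ).le_of_opNorm_le (hb ξ) u
  refine (Real.le_norm_self _).trans
    ((norm_setIntegral_le_of_norm_le_const measure_closedBall_lt_top hle).trans_eq ?_)
  rw [Measure.real, Complex.volume_closedBall]
  simp only [ENNReal.toReal_mul, ENNReal.toReal_pow, ENNReal.toReal_ofReal hr,
    ENNReal.coe_toReal, NNReal.coe_real_pi]
  ring

/-- The pointwise adjoint, composed with `ξ ↦ -ξ`, has as Fourier transform the pointwise
adjoint of the Fourier transform. -/
lemma exists_schwartzMap_star (G : 𝓢(ℂ, H →L[ℂ] H)) :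
    ∃ G' : 𝓢(ℂ, H →L[ℂ] H), (∀ ξ, G' ξ = star (G (-ξ))) ∧ ∀ w, 𝓕 G' w = star (𝓕 G w) := by
  let L : (H →L[ℂ] H) →L[ℝ] (H →L[ℂ] H) := (starL' ℝ : (H →L[ℂ] H) ≃L[ℝ] (H →L[ℂ] H))
  let G' : 𝓢(ℂ, H →L[ℂ] H) := SchwartzMap.postcompCLM (𝕜 := ℝ) L
    (SchwartzMap.compCLMOfContinuousLinearEquiv ℝ (ContinuousLinearEquiv.neg ℝ) G)
  have hG' : ∀ ξ, G' ξ = star (G (-ξ)) := fun ξ => rfl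
  refine ⟨G', hG', fun w => ?_⟩
  have hL : ∀ x, star x = L x := fun _ => rfl
  rw [SchwartzMap.fourier_coe, SchwartzMap.fourier_coe, Real.fourier_eq, Real.fourier_eq, hL,
    ← ContinuousLinearMap.integral_comp_comm, ← integral_neg_eq_self]
  · congr 1 with ξ : 1
    rw [← hL]
    simp [hG', Circle.smul_def, star_smul]
  · exact (Real.fourierIntegral_convergent_iff w).2 G.integrable

/-- Cauchy-Schwarz and Plancherel for a weighted integral of a product of Fourier transforms
of operator-valued functions. -/
lemma norm_integral_smul_fourier_mul_fourier_le (F : BoundedContinuousFunction ℂ ℂ)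
    (G₁ G₂ : 𝓢(ℂ, H →L[ℂ] H)) {r c₁ c₂ : ℝ} (hr : 0 ≤ r)
    (hs₁ : ∀ ξ, r < ‖ξ‖ → G₁ ξ = 0) (hb₁ : ∀ ξ, ‖G₁ ξ‖ ≤ c₁)
    (hs₂ : ∀ ξ, r < ‖ξ‖ → G₂ ξ = 0) (hb₂ : ∀ ξ, ‖G₂ ξ‖ ≤ c₂) :
    Integrable (fun w => F w • (𝓕 G₁ w * 𝓕 G₂ w)) ∧
    ‖∫ w, F w • (𝓕 G₁ w * 𝓕 G₂ w)‖ ≤ ‖F‖ * (c₁ * c₂ * (Real.pi * r ^ 2)) := by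
  have hc₁ : 0 ≤ c₁ := (norm_nonneg _).trans (hb₁ 0)
  have hc₂ : 0 ≤ c₂ := (norm_nonneg _).trans (hb₂ 0)
  obtain ⟨G', hG', hFG'⟩ := exists_schwartzMap_star G₁
  have hs' : ∀ ξ, r < ‖ξ‖ → G' ξ = 0 := fun ξ hξ => by
    rw [hG', hs₁ _ (by simpa using hξ), star_zero]
  have hb' : ∀ ξ, ‖G' ξ‖ ≤ c₁ := fun ξ => by rw [hG', norm_star]; exact hb₁ _
  have hint : Integrable (fun w => F w • (𝓕 G₁ w * 𝓕 G₂ w)) := by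
    have h : Integrable (fun w => 𝓕 G₁ w * 𝓕 G₂ w) :=
      (SchwartzMap.pairing (ContinuousLinearMap.mul ℂ (H →L[ℂ] H)) (𝓕 G₁) (𝓕 G₂)).integrable
    exact h.bdd_smul ‖F‖ F.continuous.aestronglyMeasurable (.of_forall F.norm_coe_le_norm)
  refine ⟨hint, ?_⟩
  refine ContinuousLinearMap.opNorm_le_of_re_inner_le (𝕜 := ℂ) (by positivity) fun u v hu hv => ?_
  obtain ⟨hm₁, hi₁⟩ := integral_norm_sq_fourier_apply_le G' hr hs' hb' v
  obtain ⟨hm₂, hi₂⟩ := integral_norm_sq_fourier_apply_le G₂ hr hs₂ hb₂ u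
  set x := fun w => ‖𝓕 G' w v‖
  set y := fun w => ‖𝓕 G₂ w u‖
  have hxy : Integrable (fun w => ‖F‖ * (x w * y w)) := (hm₁.integrable_mul hm₂).const_mul _
  have hCS : ∫ w, x w * y w ≤ (c₁ * ‖v‖) * (c₂ * ‖u‖) * (Real.pi * r ^ 2) := by
    have h := integral_mul_le_Lp_mul_Lq_of_nonneg Real.HolderConjugate.two_two
      (.of_forall fun w => norm_nonneg (𝓕 G' w v)) (.of_forall fun w => norm_nonneg (𝓕 G₂ w u))
      (by simpa using hm₁) (by simpa using hm₂)
    simp only [Real.rpow_two, ← Real.sqrt_eq_rpow] at h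
    refine h.trans ((mul_le_mul (Real.sqrt_le_sqrt hi₁) (Real.sqrt_le_sqrt hi₂)
      (Real.sqrt_nonneg _) (Real.sqrt_nonneg _)).trans_eq ?_)
    rw [Real.sqrt_mul (sq_nonneg (c₁ * ‖v‖)), Real.sqrt_mul (sq_nonneg (c₂ * ‖u‖)),
      Real.sqrt_sq (by positivity), Real.sqrt_sq (by positivity)]
    linear_combination (c₁ * ‖v‖) * (c₂ * ‖u‖) *
      Real.mul_self_sqrt (show 0 ≤ Real.pi * r ^ 2 by positivity)
  have hpt : ∀ w, ‖inner ℂ ((F w • (𝓕 G₁ w * 𝓕 G₂ w)) u) v‖ ≤ ‖F‖ * (x w * y w) := by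
    intro w
    have h : inner ℂ ((𝓕 G₁ w * 𝓕 G₂ w) u) v = inner ℂ (𝓕 G₂ w u) (𝓕 G' w v) := by
      rw [hFG', ContinuousLinearMap.star_eq_adjoint, ContinuousLinearMap.adjoint_inner_right]
      rfl
    rw [_root_.smul_apply, inner_smul_left, norm_mul, h, RCLike.norm_conj]
    refine mul_le_mul (F.norm_coe_le_norm w) ?_ (norm_nonneg _) (norm_nonneg _)
    exact (norm_inner_le_norm _ _).trans_eq (mul_comm _ _)
  have hinner : inner ℂ ((∫ w, F w • (𝓕 G₁ w * 𝓕 G₂ w)) u) v =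
      starRingEnd ℂ (∫ w, inner ℂ v ((F w • (𝓕 G₁ w * 𝓕 G₂ w)) u)) := by
    rw [integral_inner (hint.apply_continuousLinearMap u),
      ← ContinuousLinearMap.integral_apply hint, inner_conj_symm]
  refine (RCLike.re_le_norm _).trans ?_
  rw [hinner, RCLike.norm_conj]
  refine (norm_integral_le_of_norm_le hxy (.of_forall fun w => ?_)).trans ?_
  · rw [norm_inner_symm]
    exact hpt w
  · rw [integral_const_mul]
    refine (mul_le_mul_of_nonneg_left hCS (norm_nonneg F)).trans_eq ?_
    rw [hu, hv, mul_one, mul_one]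

end Plancherel

section UnitaryGroup

variable {A : Type*} [CStarAlgebra A]

open scoped ContDiff

lemma norm_exp_mul_sub_mul_exp_le {a b : A} (ha : a ∈ skewAdjoint A) (hb : b ∈ skewAdjoint A)
    (q : A) :
    ‖NormedSpace.exp a * q - q * NormedSpace.exp b‖ ≤ ‖a * q - q * b‖ := by
  let +nondep : NormedAlgebra ℚ A := .restrictScalars ℚ ℂ A
  have hu : ∀ {c : A}, c ∈ skewAdjoint A → ∀ t : ℝ, NormedSpace.exp (t • c) ∈ unitary A :=
    fun hc t => NormedSpace.exp_mem_unitary_of_mem_skewAdjoint (skewAdjoint.smul_mem t hc)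
  have hb' : -b ∈ skewAdjoint A := neg_mem hb
  let g : ℝ → A := fun t => NormedSpace.exp (t • a) * q * NormedSpace.exp (t • -b)
  have hg : ∀ t, HasDerivAt g (NormedSpace.exp (t • a) * (a * q - q * b) *
      NormedSpace.exp (t • -b)) t := by
    intro t
    convert! ((hasDerivAt_exp_smul_const (𝕂 := ℝ) a t).mul_const q).mul
      (hasDerivAt_exp_smul_const' (𝕂 := ℝ) (-b) t) using 1
    noncomm_ring
  have hle : ‖g 1 - g 0‖ ≤ ‖a * q - q * b‖ := by
    refine norm_image_sub_le_of_norm_deriv_le_segment_01' (fun t _ => (hg t).hasDerivWithinAt)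
      fun t _ => le_of_eq ?_
    rw [CStarRing.norm_mul_mem_unitary _ (hu hb' t), CStarRing.norm_mem_unitary_mul _ (hu ha t)]
  have hexp : NormedSpace.exp (-b) * NormedSpace.exp b = 1 := by
    rw [← NormedSpace.exp_add_of_commute (Commute.refl b).neg_left, neg_add_cancel,
      NormedSpace.exp_zero]
  have h : NormedSpace.exp a * q - q * NormedSpace.exp b = (g 1 - g 0) * NormedSpace.exp b := by
    simp only [g, one_smul, zero_smul, NormedSpace.exp_zero, one_mul, mul_one, sub_mul, mul_assoc,
      hexp]
  rw [h, CStarRing.norm_mul_mem_unitary _ (by simpa using hu hb 1)]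
  exact hle

/-- The skew-adjoint element `2πi Re(ξ̄ N)`. -/
noncomputable def phase (N : A) (ξ : ℂ) : A :=
  (Real.pi * Complex.I) • (star ξ • N + ξ • star N)

lemma phase_mem_skewAdjoint (N : A) (ξ : ℂ) : phase N ξ ∈ skewAdjoint A := by
  simp [skewAdjoint.mem_iff, phase, star_smul, add_comm]

lemma norm_phase_mul_sub_mul_phase_le (N₁ N₂ q : A) (ξ : ℂ) :
    ‖phase N₁ ξ * q - q * phase N₂ ξ‖ ≤
      2 * Real.pi * ‖ξ‖ * max ‖N₁ * q - q * N₂‖ ‖star N₁ * q - q * star N₂‖ := by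
  have h : phase N₁ ξ * q - q * phase N₂ ξ = (Real.pi * Complex.I) •
      (star ξ • (N₁ * q - q * N₂) + ξ • (star N₁ * q - q * star N₂)) := by
    simp only [phase, smul_mul_assoc, mul_smul_comm, add_mul, mul_add, smul_add, smul_sub]
    abel
  set m := max ‖N₁ * q - q * N₂‖ ‖star N₁ * q - q * star N₂‖
  have h₁ : ‖star ξ • (N₁ * q - q * N₂)‖ ≤ ‖ξ‖ * m := by
    rw [norm_smul, norm_star]
    gcongr
    exact le_max_left _ _
  have h₂ : ‖ξ • (star N₁ * q - q * star N₂)‖ ≤ ‖ξ‖ * m := by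
    rw [norm_smul]
    gcongr
    exact le_max_right _ _
  rw [h, norm_smul]
  have hpi : ‖(Real.pi * Complex.I : ℂ)‖ = Real.pi := by simp [abs_of_pos Real.pi_pos]
  rw [hpi]
  calc _ ≤ Real.pi * (‖ξ‖ * m + ‖ξ‖ * m) := by
        gcongr
        exact (norm_add_le _ _).trans (add_le_add h₁ h₂)
    _ = _ := by ring

lemma norm_exp_phase_mul_sub_mul_exp_phase_le (N₁ N₂ q : A) (ξ : ℂ) :
    ‖NormedSpace.exp (phase N₁ ξ) * q - q * NormedSpace.exp (phase N₂ ξ)‖ ≤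
      2 * Real.pi * ‖ξ‖ * max ‖N₁ * q - q * N₂‖ ‖star N₁ * q - q * star N₂‖ :=
  (norm_exp_mul_sub_mul_exp_le (phase_mem_skewAdjoint N₁ ξ) (phase_mem_skewAdjoint N₂ ξ) q).trans
    (norm_phase_mul_sub_mul_phase_le N₁ N₂ q ξ)

lemma norm_exp_phase_le_one (N : A) (ξ : ℂ) : ‖NormedSpace.exp (phase N ξ)‖ ≤ 1 := by
  let +nondep : NormedAlgebra ℚ A := .restrictScalars ℚ ℂ A
  have h := NormedSpace.exp_mem_unitary_of_mem_skewAdjoint (phase_mem_skewAdjoint N ξ)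
  nontriviality A
  exact (CStarRing.norm_of_mem_unitary h).le

lemma contDiff_exp_phase (N : A) : ContDiff ℝ ∞ fun ξ => NormedSpace.exp (phase N ξ) := by
  have h : ContDiff ℝ ∞ (NormedSpace.exp : A → A) :=
    contDiff_iff_contDiffAt.2 fun x => (NormedSpace.exp_analytic (𝕂 := ℝ) x).contDiffAt
  refine h.comp ?_
  have hs : ContDiff ℝ ∞ (star : ℂ → ℂ) := Complex.conjCLE.contDiff
  unfold phase
  fun_prop

lemma exp_phase_eq_cfc (N : A) (hN : IsStarNormal N) (ξ : ℂ) :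
    NormedSpace.exp (phase N ξ) = cfc (fun z : ℂ => (Real.fourierChar (inner ℝ ξ z) : ℂ)) N := by
  have hphase : phase N ξ =
      cfc (fun z : ℂ => (Real.pi * Complex.I) * (star ξ * z + ξ * star z)) N := by
    rw [cfc_const_mul _ _ N, cfc_add N _ _, cfc_const_mul_id _ N, cfc_const_mul _ _ N,
      cfc_star_id N, phase]
  have hn : IsStarNormal (phase N ξ) := by
    rw [hphase]
    exact cfc_predicate _ _
  rw [← CFC.complex_exp_eq_normedSpace_exp hn, hphase, ← cfc_comp' Complex.exp _ N]
  congr 1 with z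
  rw [Real.fourierChar_apply, Complex.inner]
  congr 1
  have h : ((star ξ * z).re : ℂ) = (star ξ * z + ξ * star z) / 2 := by
    rw [Complex.re_eq_add_conj]
    simp
  simp only [Complex.star_def] at h ⊢
  push_cast
  rw [mul_comm z, h]
  ring

end UnitaryGroup

section Reproducing

open scoped SchwartzMap Topology

lemma integral_mul_fourier_translate_eq_zero {F : ℂ → ℂ} {σ ρ : ℝ} (hF : FourierSupportedIn F σ)
    (hσ : σ < ρ) (g : 𝓢(ℂ, ℂ)) (hg : ∀ ξ, ‖ξ‖ < ρ → g ξ = 0) (z : ℂ) :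
    ∫ w, F w * 𝓕 g (w - z) = 0 := by
  let φ : 𝓢(ℂ, ℂ) := 𝓕⁻ (SchwartzMap.compSubConstCLM ℂ z (𝓕 g))
  have hφ : ∀ w, 𝓕 (⇑φ) w = 𝓕 g (w - z) := by
    intro w
    rw [← SchwartzMap.fourier_coe]
    simp [φ]
  have hzero : ∀ ξ, ‖ξ‖ < ρ → φ ξ = 0 := by
    intro ξ hξ
    have h : 𝓕⁻ (𝓕 g) ξ = 0 := by simp [hg ξ hξ]
    rw [SchwartzMap.fourierInv_coe, Real.fourierInv_eq] at h
    simp only [φ]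
    rw [SchwartzMap.fourierInv_coe, Real.fourierInv_eq, ← integral_add_right_eq_self _ z]
    simp only [SchwartzMap.compSubConstCLM_apply, add_sub_cancel_right, inner_add_left,
      AddChar.map_add_eq_mul, mul_comm _ (Real.fourierChar (inner ℝ z ξ)), mul_smul]
    simp_rw [Circle.smul_def (Real.fourierChar (inner ℝ z ξ))]
    rw [integral_smul, h, smul_zero]
  rw [← hF φ]
  · simp_rw [hφ]
  · refine Set.disjoint_left.2 fun ξ hξ hξ' => ?_
    have hsub : tsupport (⇑φ) ⊆ {ξ | ρ ≤ ‖ξ‖} := by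
      refine closure_minimal (fun x hx => ?_) (isClosed_le continuous_const continuous_norm)
      by_contra hlt
      exact hx (hzero x (not_le.1 hlt))
    have h₁ : ρ ≤ ‖ξ‖ := hsub hξ
    have h₂ : ‖ξ‖ ≤ σ := by simpa using hξ'
    linarith

/-- The Schwartz function `ξ ↦ θ (ξ / R)`. -/
lemma exists_schwartzMap_dilation (θ : 𝓢(ℂ, ℂ)) {R : ℝ} (hR : 0 < R) :
    ∃ θ' : 𝓢(ℂ, ℂ), (∀ ξ, θ' ξ = θ (R⁻¹ • ξ)) ∧ ∀ w, 𝓕 θ' w = R ^ 2 • 𝓕 θ (R • w) := by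
  have hR' : R⁻¹ ≠ 0 := inv_ne_zero hR.ne'
  let e : ℂ ≃L[ℝ] ℂ := ContinuousLinearEquiv.smulLeft (Units.mk0 R⁻¹ hR')
  let θ' := SchwartzMap.compCLMOfContinuousLinearEquiv ℂ e θ
  have hθ' : ∀ ξ, θ' ξ = θ (R⁻¹ • ξ) := fun ξ => rfl
  refine ⟨θ', hθ', fun w => ?_⟩
  rw [SchwartzMap.fourier_coe, SchwartzMap.fourier_coe, Real.fourier_eq, Real.fourier_eq]
  have h := Measure.integral_comp_inv_smul volume
    (fun v : ℂ => Real.fourierChar (-inner ℝ v (R • w)) • θ v) R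
  rw [Complex.finrank_real_complex, abs_of_nonneg (by positivity)] at h
  rw [← h]
  congr 1 with v
  rw [hθ', inner_smul_left, inner_smul_right]
  simp [hR.ne']

lemma tendsto_integral_mul_dilation (F : BoundedContinuousFunction ℂ ℂ) (k : 𝓢(ℂ, ℂ)) (z : ℂ) :
    Tendsto (fun R : ℝ => ∫ w, F w * (R ^ 2 • k (R • (w - z)))) atTop
      (𝓝 (F z * ∫ w, k w)) := by
  have hlim : Tendsto (fun R : ℝ => ∫ u, F (z + R⁻¹ • u) * k u) atTop (𝓝 (∫ u, F z * k u)) := by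
    refine tendsto_integral_filter_of_dominated_convergence (fun u => ‖F‖ * ‖k u‖) ?_ ?_ ?_ ?_
    · exact .of_forall fun R => Continuous.aestronglyMeasurable (by fun_prop)
    · refine .of_forall fun R => .of_forall fun u => ?_
      rw [norm_mul]
      gcongr
      exact F.norm_coe_le_norm _
    · exact k.integrable.norm.const_mul _
    · refine .of_forall fun u => Tendsto.mul_const _ ?_
      refine (F.continuous.tendsto z).comp ?_
      have h : Tendsto (fun R : ℝ => z + R⁻¹ • u) atTop (𝓝 (z + (0 : ℝ) • u)) :=
        (tendsto_inv_atTop_zero.smul_const u).const_add z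
      rwa [zero_smul, add_zero] at h
  rw [integral_const_mul] at hlim
  refine hlim.congr' ?_
  filter_upwards [eventually_gt_atTop 0] with R hR
  have h := Measure.integral_comp_smul volume (fun u : ℂ => F (z + R⁻¹ • u) * k u) R
  rw [Complex.finrank_real_complex, abs_of_nonneg (by positivity)] at h
  have h' : ∫ u, F (z + R⁻¹ • u) * k u =
      R ^ 2 • ∫ u, F (z + R⁻¹ • R • u) * k (R • u) := by
    rw [h, smul_inv_smul₀ (by positivity)]
  rw [h', ← integral_add_right_eq_self (fun w => F w * (R ^ 2 • k (R • (w - z)))) z,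
    ← integral_smul]
  congr 1 with u
  rw [inv_smul_smul₀ hR.ne', add_sub_cancel_right, mul_smul_comm, add_comm]

/-- A bounded function with Fourier support in a disc is reproduced by every Schwartz kernel whose
Fourier multiplier equals `1` near the disc. -/
lemma eq_integral_mul_fourier {F : BoundedContinuousFunction ℂ ℂ} {σ ρ : ℝ}
    (hF : FourierSupportedIn F σ) (hσ : σ < ρ) (ψ : 𝓢(ℂ, ℂ)) (hψ : ∀ ξ, ‖ξ‖ < ρ → ψ ξ = 1)
    (z : ℂ) : F z = ∫ w, F w * 𝓕 ψ (w - z) := by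
  let b : ContDiffBump (0 : ℂ) := ⟨1, 2, one_pos, one_lt_two⟩
  have hb : HasCompactSupport fun ξ => (b ξ : ℂ) :=
    b.hasCompactSupport.comp_left Complex.ofReal_zero
  let θ : 𝓢(ℂ, ℂ) := hb.toSchwartzMap (Complex.ofRealCLM.contDiff.comp b.contDiff)
  have hθ : ∀ ξ, ‖ξ‖ ≤ 1 → θ ξ = 1 := by
    intro ξ hξ
    have : b ξ = 1 := b.one_of_mem_closedBall (by simpa using hξ)
    change (b ξ : ℂ) = 1
    rw [this, Complex.ofReal_one]
  have hint : ∫ w, 𝓕 θ w = 1 := by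
    have h : 𝓕⁻ (𝓕 θ) 0 = 1 := by simp [hθ 0 (by simp)]
    rw [SchwartzMap.fourierInv_coe, Real.fourierInv_eq] at h
    simpa using h
  have hlim := tendsto_integral_mul_dilation F (𝓕 θ) z
  rw [hint, mul_one] at hlim
  refine tendsto_nhds_unique hlim (tendsto_const_nhds.congr' ?_)
  filter_upwards [eventually_ge_atTop ρ, eventually_gt_atTop 0] with R hR hR0
  obtain ⟨θ', hθ', hFθ'⟩ := exists_schwartzMap_dilation θ hR0
  have hzero := integral_mul_fourier_translate_eq_zero hF hσ (θ' - ψ) (fun ξ hξ => by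
    rw [_root_.sub_apply, hψ ξ hξ, hθ', hθ, sub_self]
    rw [norm_smul, norm_inv, Real.norm_of_nonneg hR0.le, inv_mul_le_one₀ hR0]
    linarith) z
  have hi : ∀ k : 𝓢(ℂ, ℂ), Integrable fun w => F w * k (w - z) := fun k =>
    (k.integrable.comp_sub_right z).bdd_mul F.continuous.aestronglyMeasurable
      (.of_forall F.norm_coe_le_norm)
  have hsub : 𝓕 (θ' - ψ) = 𝓕 θ' - 𝓕 ψ := map_sub (FourierTransform.fourierCLM ℂ 𝓢(ℂ, ℂ)) θ' ψ
  simp_rw [hsub, _root_.sub_apply, mul_sub] at hzero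
  rw [integral_sub (hi _) (hi _), sub_eq_zero] at hzero
  simp_rw [← hFθ']
  exact hzero.symm

end Reproducing

section FunctionalCalculus

open scoped SchwartzMap ContDiff

variable {A : Type*} [CStarAlgebra A]

/-- The operator-valued symbol `ξ ↦ α ξ • exp (2πi Re(ξ̄ N))`. -/
lemma exists_schwartzMap_smul_exp_phase (α : 𝓢(ℂ, ℂ)) (hα : HasCompactSupport α) (N : A) :
    ∃ G : 𝓢(ℂ, A), ∀ ξ, G ξ = α ξ • NormedSpace.exp (phase N ξ) :=
  ⟨HasCompactSupport.toSchwartzMap (f := fun ξ => α ξ • NormedSpace.exp (phase N ξ))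
    hα.smul_right ((α.smooth ⊤).smul (contDiff_exp_phase N)), fun _ => rfl⟩

lemma cfc_fourier_sub_eq (α : 𝓢(ℂ, ℂ)) {N : A} (hN : IsStarNormal N) {G : 𝓢(ℂ, A)}
    (hG : ∀ ξ, G ξ = α ξ • NormedSpace.exp (phase N ξ)) (w : ℂ) :
    cfc (fun z => 𝓕 α (w - z)) N = 𝓕 G w := by
  have hchar : ∀ ξ, Continuous fun z : ℂ => (Real.fourierChar (inner ℝ ξ z) : ℂ) := fun ξ => by
    fun_prop
  simp_rw [SchwartzMap.fourier_coe, Real.fourier_eq]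
  rw [cfc_integral (fun ξ z => Real.fourierChar (-inner ℝ ξ (w - z)) • α ξ) (fun ξ => ‖α ξ‖) N]
  · congr 1 with ξ
    rw [hG, exp_phase_eq_cfc N hN, Circle.smul_def, ← smul_assoc, ← cfc_const_mul _ _ N]
    congr 1 with z
    rw [inner_sub_right, neg_sub, sub_eq_neg_add, AddChar.map_add_eq_mul, Circle.smul_def,
      Circle.coe_mul, smul_eq_mul, smul_eq_mul]
    ring
  · refine Continuous.continuousOn ?_
    have := α.continuous
    simp only [Function.uncurry_def, Circle.smul_def]
    fun_prop
  · exact .of_forall fun ξ z _ => by simp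
  · exact α.integrable.norm.2

lemma exists_integrable_bound_translate (k : 𝓢(ℂ, ℂ)) (R : ℝ) :
    ∃ B : ℂ → ℝ, Integrable B ∧ ∀ w z, ‖z‖ ≤ R → ‖k (w - z)‖ ≤ B w := by
  obtain ⟨C, hC⟩ : ∃ C, ∀ x, (1 + ‖x‖) ^ 3 * ‖k x‖ ≤ C := by
    have := fun x => SchwartzMap.one_add_le_sup_seminorm_apply (𝕜 := ℂ) (m := (3, 0))
      le_rfl le_rfl k x
    simp only [norm_iteratedFDeriv_zero] at this
    exact ⟨_, this⟩
  refine ⟨fun w => (1 + ‖w‖) ^ (-3 : ℝ) * ((1 + R) ^ 3 * C), ?_, fun w z hz => ?_⟩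
  · refine (integrable_one_add_norm ?_).mul_const _
    rw [Complex.finrank_real_complex]
    norm_num
  · have hw : 1 + ‖w‖ ≤ (1 + R) * (1 + ‖w - z‖) := by
      have h : ‖w‖ ≤ ‖w - z‖ + ‖z‖ := by simpa using norm_add_le (w - z) z
      nlinarith [norm_nonneg z, norm_nonneg (w - z)]
    have h3 : (1 + ‖w‖) ^ 3 ≤ (1 + R) ^ 3 * (1 + ‖w - z‖) ^ 3 := by
      rw [← mul_pow]
      gcongr
    have hpos : 0 < (1 + ‖w‖) ^ 3 := by positivity
    beta_reduce
    rw [Real.rpow_neg (by positivity), ← div_eq_inv_mul]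
    norm_cast
    rw [le_div_iff₀ hpos]
    calc ‖k (w - z)‖ * (1 + ‖w‖) ^ 3 ≤ ‖k (w - z)‖ * ((1 + R) ^ 3 * (1 + ‖w - z‖) ^ 3) := by gcongr
      _ = (1 + R) ^ 3 * ((1 + ‖w - z‖) ^ 3 * ‖k (w - z)‖) := by ring
      _ ≤ (1 + R) ^ 3 * C := by
        have hR : 0 ≤ R := (norm_nonneg z).trans hz
        gcongr
        exact hC _

/-- Integral representation of `f(N)` for `f = ∫ f(w) k(w - ·) dw` with a Schwartz kernel `k`. -/
lemma cfc_eq_integral_smul_cfc (F : BoundedContinuousFunction ℂ ℂ) (k : 𝓢(ℂ, ℂ))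
    (hF : ∀ z, F z = ∫ w, F w * k (w - z)) {N : A} (hN : IsStarNormal N) :
    cfc F N = ∫ w, F w • cfc (fun z => k (w - z)) N := by
  obtain ⟨R, hR⟩ := (spectrum.isBounded (𝕜 := ℂ) N).exists_norm_le
  obtain ⟨B, hBi, hB⟩ := exists_integrable_bound_translate k R
  have h : (F : ℂ → ℂ) = fun z => ∫ w, F w * k (w - z) := funext hF
  conv_lhs => rw [h]
  have hk := k.continuous
  rw [cfc_integral (fun w z => F w * k (w - z)) (fun w => ‖F‖ * B w) N]
  · congr 1 with w
    rw [cfc_const_mul (F w) (fun z => k (w - z)) N (by fun_prop)]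
  · refine Continuous.continuousOn ?_
    simp only [Function.uncurry_def]
    fun_prop
  · refine .of_forall fun w z hz => ?_
    rw [norm_mul]
    exact mul_le_mul (F.norm_coe_le_norm w) (hB w z (hR z hz)) (norm_nonneg _) (norm_nonneg _)
  · exact (hBi.const_mul _).2

end FunctionalCalculus

section Kernel

open scoped SchwartzMap

/-- A pair of compactly supported symbols whose Fourier transforms multiply to a reproducing kernel
for bounded functions with spectrum in the disc of radius `σ`. -/
lemma exists_reproducing_pair {σ : ℝ} (hσ : 0 < σ) :
    ∃ b a : 𝓢(ℂ, ℂ), (HasCompactSupport b ∧ HasCompactSupport a) ∧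
      ((∀ ξ, 4 * σ < ‖ξ‖ → b ξ = 0) ∧ ∀ ξ, 4 * σ < ‖ξ‖ → a ξ = 0) ∧
      ((∀ ξ, ‖b ξ‖ ≤ 4 / (Real.pi * σ ^ 2)) ∧ ∀ ξ, ‖a ξ‖ ≤ 1) ∧
      ∀ F : BoundedContinuousFunction ℂ ℂ, FourierSupportedIn F σ →
        ∀ z, F z = ∫ w, F w * (𝓕 b (w - z) * 𝓕 a (w - z)) := by
  let β : ContDiffBump (0 : ℂ) := ⟨σ / 2, σ, by positivity, by linarith⟩
  let α : ContDiffBump (0 : ℂ) := ⟨3 * σ, 4 * σ, by positivity, by linarith⟩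
  have hβ : HasCompactSupport fun ξ => (β.normed volume ξ : ℂ) :=
    β.hasCompactSupport_normed.comp_left Complex.ofReal_zero
  have hα : HasCompactSupport fun ξ => (α ξ : ℂ) :=
    α.hasCompactSupport.comp_left Complex.ofReal_zero
  let b : 𝓢(ℂ, ℂ) := hβ.toSchwartzMap (Complex.ofRealCLM.contDiff.comp β.contDiff_normed)
  let a : 𝓢(ℂ, ℂ) := hα.toSchwartzMap (Complex.ofRealCLM.contDiff.comp α.contDiff)
  have hb : ∀ ξ, b ξ = (β.normed volume ξ : ℂ) := fun _ => rfl
  have ha : ∀ ξ, a ξ = (α ξ : ℂ) := fun _ => rfl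
  have hconv : ∀ ξ : ℂ, ‖ξ‖ < 2 * σ →
      SchwartzMap.convolution (ContinuousLinearMap.mul ℂ ℂ) b a ξ = 1 := by
    intro ξ hξ
    have hone : ∀ x ∈ Metric.ball ξ σ, a x = 1 := by
      intro x hx
      rw [ha, α.one_of_mem_closedBall, Complex.ofReal_one]
      rw [mem_ball_iff_norm] at hx
      rw [mem_closedBall_zero_iff]
      change ‖x‖ ≤ 3 * σ
      linarith [norm_le_norm_sub_add x ξ]
    rw [SchwartzMap.convolution_apply, convolution_eq_right' (R := σ)]
    · simp only [hone ξ (Metric.mem_ball_self hσ), hb, ContinuousLinearMap.mul_apply', mul_one]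
      exact (integral_ofReal (f := β.normed volume)).trans
        (by rw [β.integral_normed, RCLike.ofReal_one])
    · intro x hx
      have : x ∈ Function.support (β.normed volume) := by simpa [hb] using hx
      rwa [β.support_normed_eq] at this
    · exact fun x hx => by rw [hone x hx, hone ξ (Metric.mem_ball_self hσ)]
  refine ⟨b, a, ⟨hβ, hα⟩, ⟨fun ξ hξ => ?_, fun ξ hξ => ?_⟩, ⟨fun ξ => ?_, fun ξ => ?_⟩,
    fun F hF z => ?_⟩
  · have : ξ ∉ Function.support (β.normed volume) := by
      rw [β.support_normed_eq, mem_ball_zero_iff]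
      change ¬ ‖ξ‖ < σ
      linarith
    rw [hb, Function.notMem_support.1 this, Complex.ofReal_zero]
  · rw [ha, α.zero_of_le_dist, Complex.ofReal_zero]
    rw [dist_zero_right]
    exact hξ.le
  · rw [hb, Complex.norm_real, Real.norm_of_nonneg (β.nonneg_normed ξ)]
    refine (β.normed_le_div_measure_closedBall_rIn volume ξ).trans_eq ?_
    rw [Measure.real, Complex.volume_closedBall]
    change 1 / (ENNReal.ofReal (σ / 2) ^ 2 * NNReal.pi).toReal = _
    rw [ENNReal.toReal_mul, ENNReal.toReal_pow, ENNReal.toReal_ofReal (by positivity)]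
    simp only [ENNReal.coe_toReal, NNReal.coe_real_pi]
    field_simp
    norm_num
  · rw [ha, Complex.norm_real, Real.norm_of_nonneg α.nonneg]
    exact α.le_one
  · rw [eq_integral_mul_fourier hF (by linarith) _ hconv z]
    congr 1 with w
    rw [SchwartzMap.fourier_convolution_apply,
      Real.fourier_bilin_convolution_eq _ b.integrable a.integrable]
    rfl

end Kernel

section QuasiCommutator

open scoped SchwartzMap

lemma exists_schwartzMap_quasicommutator {A : Type*} [CStarAlgebra A] {α : 𝓢(ℂ, ℂ)} {c r : ℝ}
    (hs : ∀ ξ, r < ‖ξ‖ → α ξ = 0) (hc : ∀ ξ, ‖α ξ‖ ≤ c) (hr : 0 ≤ r) {N₁ N₂ : A}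
    {G₁ G₂ : 𝓢(ℂ, A)} (hG₁ : ∀ ξ, G₁ ξ = α ξ • NormedSpace.exp (phase N₁ ξ))
    (hG₂ : ∀ ξ, G₂ ξ = α ξ • NormedSpace.exp (phase N₂ ξ)) (q : A) :
    ∃ D : 𝓢(ℂ, A), (∀ ξ, r < ‖ξ‖ → D ξ = 0) ∧
      (∀ ξ, ‖D ξ‖ ≤ c * (2 * Real.pi * r *
        max ‖N₁ * q - q * N₂‖ ‖star N₁ * q - q * star N₂‖)) ∧
      ∀ w, 𝓕 D w = 𝓕 G₁ w * q - q * 𝓕 G₂ w := by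
  have hD : ∀ ξ, (SchwartzMap.postcompCLM ((ContinuousLinearMap.mul ℂ A).flip q) G₁ -
      SchwartzMap.postcompCLM (ContinuousLinearMap.mul ℂ A q) G₂) ξ =
      α ξ • (NormedSpace.exp (phase N₁ ξ) * q - q * NormedSpace.exp (phase N₂ ξ)) := by
    intro ξ
    simp [hG₁, hG₂, smul_sub]
  refine ⟨SchwartzMap.postcompCLM ((ContinuousLinearMap.mul ℂ A).flip q) G₁ -
    SchwartzMap.postcompCLM (ContinuousLinearMap.mul ℂ A q) G₂,
    fun ξ hξ => ?_, fun ξ => ?_, fun w => ?_⟩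
  · rw [hD, hs ξ hξ, zero_smul]
  · rw [hD]
    rcases lt_or_ge r ‖ξ‖ with hξ | hξ
    · rw [hs ξ hξ, zero_smul, norm_zero]
      have := (norm_nonneg _).trans (hc ξ)
      positivity
    · rw [norm_smul]
      refine mul_le_mul (hc ξ) ((norm_exp_phase_mul_sub_mul_exp_phase_le N₁ N₂ q ξ).trans ?_)
        (norm_nonneg _) ((norm_nonneg _).trans (hc ξ))
      gcongr
  · rw [← FourierTransform.fourierCLM_apply (R := ℂ), map_sub]
    simp [fourier_postcompCLM_apply]

variable {H : Type*} [NormedAddCommGroup H] [InnerProductSpace ℂ H] [CompleteSpace H]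

lemma norm_cfc_mul_sub_mul_cfc_le_of_fourierSupportedIn (F : BoundedContinuousFunction ℂ ℂ) {σ : ℝ}
    (hσ : 0 < σ) (hF : FourierSupportedIn F σ) {N₁ N₂ : H →L[ℂ] H} (hN₁ : IsStarNormal N₁)
    (hN₂ : IsStarNormal N₂) (Q : H →L[ℂ] H) :
    ‖cfc F N₁ * Q - Q * cfc F N₂‖ ≤ 1024 * Real.pi * σ * ‖F‖ *
      max ‖N₁ * Q - Q * N₂‖ ‖star N₁ * Q - Q * star N₂‖ := by
  obtain ⟨b, a, ⟨hbc, hac⟩, ⟨hbs, has⟩, ⟨hbn, han⟩, hrep⟩ := exists_reproducing_pair hσ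
  set δ := max ‖N₁ * Q - Q * N₂‖ ‖star N₁ * Q - Q * star N₂‖
  obtain ⟨B₁, hB₁⟩ := exists_schwartzMap_smul_exp_phase b hbc N₁
  obtain ⟨B₂, hB₂⟩ := exists_schwartzMap_smul_exp_phase b hbc N₂
  obtain ⟨A₁, hA₁⟩ := exists_schwartzMap_smul_exp_phase a hac N₁
  obtain ⟨A₂, hA₂⟩ := exists_schwartzMap_smul_exp_phase a hac N₂
  have hr : 0 ≤ 4 * σ := by positivity
  obtain ⟨DB, hDBs, hDBn, hDB⟩ := exists_schwartzMap_quasicommutator hbs hbn hr hB₁ hB₂ Q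
  obtain ⟨DA, hDAs, hDAn, hDA⟩ := exists_schwartzMap_quasicommutator has han hr hA₁ hA₂ Q
  have hsupp : ∀ {α : 𝓢(ℂ, ℂ)} {N : H →L[ℂ] H} {G : 𝓢(ℂ, H →L[ℂ] H)},
      (∀ ξ, 4 * σ < ‖ξ‖ → α ξ = 0) → (∀ ξ, G ξ = α ξ • NormedSpace.exp (phase N ξ)) →
      ∀ ξ, 4 * σ < ‖ξ‖ → G ξ = 0 := fun hα hG ξ hξ => by rw [hG, hα ξ hξ, zero_smul]
  have hnorm : ∀ {α : 𝓢(ℂ, ℂ)} {N : H →L[ℂ] H} {G : 𝓢(ℂ, H →L[ℂ] H)} {c : ℝ},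
      (∀ ξ, ‖α ξ‖ ≤ c) → (∀ ξ, G ξ = α ξ • NormedSpace.exp (phase N ξ)) →
      ∀ ξ, ‖G ξ‖ ≤ c := fun hα hG ξ => by
    rw [hG, norm_smul]
    exact (mul_le_of_le_one_right (norm_nonneg _) (norm_exp_phase_le_one _ ξ)).trans (hα ξ)
  have hint : ∀ {N : H →L[ℂ] H} (_ : IsStarNormal N) {B A : 𝓢(ℂ, H →L[ℂ] H)},
      (∀ ξ, B ξ = b ξ • NormedSpace.exp (phase N ξ)) →
      (∀ ξ, A ξ = a ξ • NormedSpace.exp (phase N ξ)) →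
      Integrable (fun w => F w • (𝓕 B w * 𝓕 A w)) ∧
      cfc F N = ∫ w, F w • (𝓕 B w * 𝓕 A w) := by
    intro N hN B A hB hA
    refine ⟨(norm_integral_smul_fourier_mul_fourier_le F B A hr (hsupp hbs hB) (hnorm hbn hB)
      (hsupp has hA) (hnorm han hA)).1, ?_⟩
    rw [cfc_eq_integral_smul_cfc F (SchwartzMap.pairing (ContinuousLinearMap.mul ℂ ℂ) (𝓕 b) (𝓕 a))
      (hrep F hF) hN]
    congr 1 with w : 1
    have h₁ := (𝓕 b).continuous
    have h₂ := (𝓕 a).continuous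
    rw [← cfc_fourier_sub_eq b hN hB, ← cfc_fourier_sub_eq a hN hA,
      ← cfc_mul (fun z => 𝓕 b (w - z)) (fun z => 𝓕 a (w - z)) N (by fun_prop) (by fun_prop)]
    rfl
  obtain ⟨hi₁, he₁⟩ := hint hN₁ hB₁ hA₁
  obtain ⟨hi₂, he₂⟩ := hint hN₂ hB₂ hA₂
  obtain ⟨hiA, hleA⟩ := norm_integral_smul_fourier_mul_fourier_le F B₁ DA hr (hsupp hbs hB₁)
    (hnorm hbn hB₁) hDAs hDAn
  obtain ⟨hiB, hleB⟩ := norm_integral_smul_fourier_mul_fourier_le F DB A₂ hr hDBs hDBn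
    (hsupp has hA₂) (hnorm han hA₂)
  have key : cfc F N₁ * Q - Q * cfc F N₂ =
      (∫ w, F w • (𝓕 B₁ w * 𝓕 DA w)) + ∫ w, F w • (𝓕 DB w * 𝓕 A₂ w) := by
    rw [he₁, he₂, ← integral_mul_const_of_integrable hi₁, ← integral_const_mul_of_integrable hi₂,
      ← integral_add hiA hiB, ← integral_sub (hi₁.mul_const Q) (hi₂.const_mul Q)]
    congr 1 with w : 1
    rw [hDA, hDB, smul_mul_assoc, mul_smul_comm, ← smul_sub, ← smul_add]
    noncomm_ring
  rw [key]
  refine (norm_add_le _ _).trans ((add_le_add hleA hleB).trans_eq ?_)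
  field_simp
  ring

end QuasiCommutator

/-- Quasicommutator version of operator Lipschitzness for `B¹_{∞1}(ℝ²)` functions:
`‖f(N₁)Q - Q f(N₂)‖ ≤ C M max{‖N₁Q - QN₂‖, ‖N₁*Q - QN₂*‖}`. -/
theorem besov_operator_lipschitz_quasicommutator :
    ∃ C : ℝ, 0 < C ∧
      ∀ (f : ℂ → ℂ) (M : ℝ), HasLPDecompBesov1 f M →
      ∀ (H : Type*) [NormedAddCommGroup H] [InnerProductSpace ℂ H] [CompleteSpace H]
        (N₁ N₂ : H →L[ℂ] H), IsStarNormal N₁ → IsStarNormal N₂ →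
        ∀ Q : H →L[ℂ] H,
        ‖cfc f N₁ * Q - Q * cfc f N₂‖ ≤
          C * M * max ‖N₁ * Q - Q * N₂‖ ‖star N₁ * Q - Q * star N₂‖ := by
  refine ⟨2048 * Real.pi, by positivity, fun f M ⟨F, hF, hlim, hsum, hM⟩ => ?_⟩
  intro H _ _ _ N₁ N₂ hN₁ hN₂ Q
  set δ := max ‖N₁ * Q - Q * N₂‖ ‖star N₁ * Q - Q * star N₂‖
  have hcfc : ∀ {N : H →L[ℂ] H}, Tendsto
      (fun n : ℕ => ∑ k ∈ Finset.Icc (-(n : ℤ)) n, cfc (F k) N) atTop (nhds (cfc f N)) := by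
    intro N
    refine (tendsto_cfc_fun (hlim _ (spectrum.isCompact N))
      (.of_forall fun n => Continuous.continuousOn (by fun_prop))).congr fun n => ?_
    rw [← cfc_sum _ _ _ fun k _ => (F k).continuous.continuousOn]
    congr 1 with z
    simp
  refine le_of_tendsto ((hcfc.mul_const Q).sub (hcfc.const_mul Q)).norm (.of_forall fun n => ?_)
  rw [Finset.sum_mul, Finset.mul_sum, ← Finset.sum_sub_distrib]
  calc ‖∑ k ∈ Finset.Icc (-(n : ℤ)) n, (cfc (F k) N₁ * Q - Q * cfc (F k) N₂)‖
      ≤ ∑ k ∈ Finset.Icc (-(n : ℤ)) n, 2048 * Real.pi * δ * ((2 : ℝ) ^ k * ‖F k‖) := by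
        refine norm_sum_le_of_le _ fun k _ => ?_
        refine (norm_cfc_mul_sub_mul_cfc_le_of_fourierSupportedIn (F k) (by positivity) (hF k)
          hN₁ hN₂ Q).trans_eq ?_
        rw [zpow_add_one₀ two_ne_zero]
        ring
    _ = 2048 * Real.pi * δ * ∑ k ∈ Finset.Icc (-(n : ℤ)) n, (2 : ℝ) ^ k * ‖F k‖ := by
        rw [Finset.mul_sum]
    _ ≤ 2048 * Real.pi * δ * M := by
        gcongr
        exact (hsum.sum_le_tsum _ fun k _ => by positivity).trans hM
    _ = 2048 * Real.pi * M * δ := by ring
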